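/- Let F : ℝ² → ℝ be n-times continuously differentiable near (x₀, y₀), and let y : ℝ → ℝ be an n-times differentiable function near x₀ with y(x₀) = y₀ such that F(x, y(x)) = 0 for all x near x₀ and F_y(x₀, y₀) ≠ 0. Then for every n ≥ 1, the nth derivative y^(n)(x₀) equals the sum over k from 1 to 2n−1 of (−1)ᵏ · [F_y(x₀,y₀)]^(−k) · I_{n,k}(x₀, y₀). -/

import Mathlib

/-- `pd F a b x y = ∂^(a+b) F / ∂x^a ∂y^b` evaluated at `(x, y)`:
differentiate `F` `a` times in the first variable, then `b` times in the second. -/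
noncomputable def pd (F : ℝ → ℝ → ℝ) (a b : ℕ) (x y : ℝ) : ℝ :=
  iteratedDeriv b (fun y' => iteratedDeriv a (fun x' => F x' y') x) y

open scoped Classical in
/-- `iSum F n k x y` is `I_{n,k}` evaluated at `(x, y)`: the sum over all set
partitions of `{1, …, n+k−1}` (encoded as `Fin (n + k - 1)`; the *small*
elements `{1, …, n}` correspond to values `< n` and the *large* elements
`{n+1, …, n+k−1}` to values `≥ n`) into `k` blocks in which no large element
lies in a singleton block, of the products over the blocks `B` of
`∂^(a+b)F/∂x^a∂y^b`, where `a` is the number of small and `b` the number of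
large elements of `B`.  It is `0` when `k < 1` or when no such partition
exists (empty sum). -/
noncomputable def iSum (F : ℝ → ℝ → ℝ) (n : ℕ) (k : ℤ) (x y : ℝ) : ℝ :=
  if k < 1 then 0 else
    ∑ part ∈ Finset.univ.filter (fun part : Finset (Finset (Fin (n + k.toNat - 1))) =>
        (∀ B ∈ part, B.Nonempty) ∧
        (∀ i, ∃! B, B ∈ part ∧ i ∈ B) ∧
        part.card = k.toNat ∧
        ∀ B ∈ part, B.card = 1 → ∀ i ∈ B, (i : ℕ) < n),
      ∏ B ∈ part,
        pd F (B.filter (fun i => (i : ℕ) < n)).card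
             (B.filter (fun i => ¬ (i : ℕ) < n)).card x y

def IsPt {α : Type*} (c : Finset (Finset α)) (S : Finset α) : Prop :=
  (∀ B ∈ c, B.Nonempty) ∧ (∀ B ∈ c, ∀ i ∈ B, i ∈ S) ∧ (∀ i ∈ S, ∃ B ∈ c, i ∈ B) ∧
  ∀ B ∈ c, ∀ B' ∈ c, ∀ i, i ∈ B → i ∈ B' → B = B'

open scoped Classical in
noncomputable def pts {α : Type*} (S : Finset α) (k : ℕ) : Finset (Finset (Finset α)) :=
  S.powerset.powerset.filter (fun c => IsPt c S ∧ c.card = k)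

open scoped Classical in
theorem mem_pts {α : Type*} (S : Finset α) (k : ℕ) (c : Finset (Finset α)) :
    c ∈ pts S k ↔ IsPt c S ∧ c.card = k := by
  unfold pts
  rw [Finset.mem_filter]
  constructor
  · exact fun h => h.2
  · refine fun h => ⟨?_, h⟩
    rw [Finset.mem_powerset]
    intro B hB
    rw [Finset.mem_powerset]
    exact h.1.2.1 B hB

theorem pts_insert {α : Type*} [DecidableEq α] {R : Type*} [CommRing R] (g : Finset α → R)
    (S : Finset α) (e : α) (he : e ∉ S) (k : ℕ) :
    ∑ c ∈ pts (insert e S) (k+1), ∏ B ∈ c, g B =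
      g {e} * ∑ c ∈ pts S k, ∏ B ∈ c, g B +
      ∑ c ∈ pts S (k+1), ∑ B ∈ c, g (insert e B) * ∏ B' ∈ c.erase B, g B' := by
  rw [← Finset.sum_filter_add_sum_filter_not _ (fun c => {e} ∈ c)]
  congr 1
  · rw [Finset.mul_sum]
    symm
    refine Finset.sum_bij' (fun c _ => insert {e} c) (fun c _ => c.erase {e}) ?_ ?_ ?_ ?_ ?_
    · intro c hc
      rw [mem_pts] at hc
      obtain ⟨⟨h1, h2, h3, h4⟩, h5⟩ := hc
      have hne : {e} ∉ c := fun h => he (h2 _ h e (by simp))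
      rw [Finset.mem_filter, mem_pts]
      refine ⟨⟨⟨?_, ?_, ?_, ?_⟩, ?_⟩, by simp⟩
      · intro B hB
        rcases Finset.mem_insert.1 hB with rfl | hB
        · simp
        · exact h1 B hB
      · grind
      · intro i hi
        rcases Finset.mem_insert.1 hi with rfl | hi
        · exact ⟨{i}, by simp⟩
        · grind
      · grind
      · rw [Finset.card_insert_of_notMem hne, h5]
    · intro c hc
      rw [Finset.mem_filter, mem_pts] at hc
      obtain ⟨⟨⟨h1, h2, h3, h4⟩, h5⟩, h6⟩ := hc
      rw [mem_pts]
      refine ⟨⟨?_, ?_, ?_, ?_⟩, ?_⟩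
      · grind
      · intro B hB i hi
        have hB' := Finset.mem_erase.1 hB
        have := h2 B hB'.2 i hi
        rcases Finset.mem_insert.1 this with rfl | h
        · exact absurd (h4 B hB'.2 _ h6 i hi (by simp)) hB'.1
        · exact h
      · grind
      · grind
      · rw [Finset.card_erase_of_mem h6, h5]; rfl
    · intro c hc
      rw [mem_pts] at hc
      obtain ⟨⟨h1, h2, h3, h4⟩, h5⟩ := hc
      have hne : {e} ∉ c := fun h => he (h2 _ h e (by simp))
      simp [hne]
    · intro c hc
      rw [Finset.mem_filter, mem_pts] at hc
      exact Finset.insert_erase hc.2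
    · intro c hc
      rw [mem_pts] at hc
      obtain ⟨⟨h1, h2, h3, h4⟩, h5⟩ := hc
      have hne : {e} ∉ c := fun h => he (h2 _ h e (by simp))
      rw [Finset.prod_insert hne]
  · rw [Finset.sum_sigma']
    symm
    refine Finset.sum_nbij (fun x => insert (insert e x.2) (x.1.erase x.2)) ?_ ?_ ?_ ?_
    · rintro ⟨c, B⟩ hc
      simp only [Finset.mem_sigma, mem_pts] at hc
      obtain ⟨⟨⟨h1, h2, h3, h4⟩, h5⟩, hB⟩ := hc
      have hn : insert e B ∉ c.erase B := by grind
      have hne : ({e} : Finset α) ∉ insert (insert e B) (c.erase B) := by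
        intro h
        rcases Finset.mem_insert.1 h with h | h
        · obtain ⟨i, hi⟩ := h1 B hB
          have : i ∈ ({e} : Finset α) := by rw [h]; simp [hi]
          grind
        · have := h2 _ (Finset.mem_of_mem_erase h) e (by simp)
          exact he this
      simp only [Finset.mem_filter, mem_pts]
      refine ⟨⟨⟨?_, ?_, ?_, ?_⟩, ?_⟩, hne⟩
      · intro B' hB'
        rcases Finset.mem_insert.1 hB' with rfl | hB'
        · simp
        · exact h1 _ (Finset.mem_of_mem_erase hB')
      · grind
      · intro i hi
        rcases Finset.mem_insert.1 hi with rfl | hi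
        · exact ⟨insert i B, by simp⟩
        · obtain ⟨B', hB', hi'⟩ := h3 i hi
          by_cases hBB : B' = B
          · exact ⟨insert e B, by simp, by subst hBB; simp [hi']⟩
          · exact ⟨B', by simp [hBB, hB'], hi'⟩
      · grind
      · rw [Finset.card_insert_of_notMem hn, Finset.card_erase_of_mem hB, h5]; rfl
    · rintro ⟨c, B⟩ hc ⟨c', B'⟩ hc' heq
      simp only [Finset.mem_coe, Finset.mem_sigma, mem_pts] at hc hc'
      obtain ⟨⟨⟨h1, h2, h3, h4⟩, h5⟩, hB⟩ := hc
      obtain ⟨⟨⟨h1', h2', h3', h4'⟩, h5'⟩, hB'⟩ := hc'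
      simp only at heq
      have heB : e ∉ B := fun h => he (h2 _ hB e h)
      have heB' : e ∉ B' := fun h => he (h2' _ hB' e h)
      have hBe : insert e B = insert e B' := by
        have : insert e B ∈ insert (insert e B') (c'.erase B') := by rw [← heq]; simp
        rcases Finset.mem_insert.1 this with h | h
        · exact h
        · exact absurd (h2' _ (Finset.mem_of_mem_erase h) e (by simp)) he
      have hBB : B = B' := by
        rw [← Finset.erase_insert heB, hBe, Finset.erase_insert heB']
      subst hBB
      have hn : insert e B ∉ c.erase B := by grind
      have hn' : insert e B ∉ c'.erase B := by grind
      have : c.erase B = c'.erase B := by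
        rw [← Finset.erase_insert hn, heq, Finset.erase_insert hn']
      have : c = c' := by
        rw [← Finset.insert_erase hB, this, Finset.insert_erase hB']
      subst this
      rfl
    · intro c hc
      simp only [Finset.coe_filter, Set.mem_ofPred_eq, mem_pts] at hc
      obtain ⟨⟨⟨h1, h2, h3, h4⟩, h5⟩, hne⟩ := hc
      obtain ⟨A, hA, heA⟩ := h3 e (by simp)
      have hAn : (A.erase e).Nonempty := by
        rw [Finset.nonempty_iff_ne_empty]
        intro h
        apply hne
        rw [← Finset.insert_erase heA, h] at hA
        simpa using hA
      have hAc : A.erase e ∉ c := by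
        intro h
        obtain ⟨i, hi⟩ := hAn
        have := h4 _ h _ hA i hi (Finset.mem_of_mem_erase hi)
        rw [← this] at heA
        simp at heA
      have hn : A.erase e ∉ c.erase A := fun h => hAc (Finset.mem_of_mem_erase h)
      refine ⟨⟨insert (A.erase e) (c.erase A), A.erase e⟩, ?_, ?_⟩
      · simp only [Finset.mem_coe, Finset.mem_sigma, mem_pts]
        refine ⟨⟨⟨?_, ?_, ?_, ?_⟩, ?_⟩, by simp⟩
        · intro B hB
          rcases Finset.mem_insert.1 hB with rfl | hB
          · exact hAn
          · exact h1 _ (Finset.mem_of_mem_erase hB)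
        · intro B hB i hi
          have hne : i ≠ e := by grind
          rcases Finset.mem_insert.1 hB with rfl | hB
          · have := h2 A hA i (by grind)
            grind
          · have := h2 B (by grind) i hi
            grind
        · intro i hi
          obtain ⟨B, hB, hiB⟩ := h3 i (by simp [hi])
          by_cases hBA : B = A
          · exact ⟨A.erase e, by simp, by grind⟩
          · exact ⟨B, by simp [hBA, hB], hiB⟩
        · grind
        · rw [Finset.card_insert_of_notMem hn, Finset.card_erase_of_mem hA, h5]; rfl
      · simp only
        rw [Finset.insert_erase heA, Finset.erase_insert hn, Finset.insert_erase hA]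
    · rintro ⟨c, B⟩ hc
      simp only [Finset.mem_sigma, mem_pts] at hc
      obtain ⟨⟨⟨h1, h2, h3, h4⟩, h5⟩, hB⟩ := hc
      have hn : insert e B ∉ c.erase B := by grind
      simp only
      rw [Finset.prod_insert hn]

open MvPolynomial in
theorem leib_prod {ι : Type*} [DecidableEq ι] (D : Derivation ℝ (MvPolynomial (ℕ × ℕ) ℝ) (MvPolynomial (ℕ × ℕ) ℝ))
    (c : Finset ι) (f : ι → MvPolynomial (ℕ × ℕ) ℝ) :
    D (∏ B ∈ c, f B) = ∑ B ∈ c, D (f B) * ∏ B' ∈ c.erase B, f B' := by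
  induction c using Finset.induction_on with
  | empty => simp
  | insert a s ha ih =>
    rw [Finset.prod_insert ha, Finset.sum_insert ha, Derivation.leibniz, ih, Finset.erase_insert ha,
      smul_eq_mul, smul_eq_mul, add_comm, Finset.mul_sum]
    congr 1
    · ring
    · refine Finset.sum_congr rfl fun B hB => ?_
      have hne : a ≠ B := fun h => ha (h ▸ hB)
      rw [Finset.erase_insert_of_ne hne, Finset.prod_insert (by simp [ha])]
      ring

def cnt {α : Type*} (p : α → Bool) (B : Finset α) : ℕ × ℕ :=
  ((B.filter (fun i => p i = true)).card, (B.filter (fun i => ¬ p i = true)).card)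

noncomputable def TX {α : Type*} (p : α → Bool) (S : Finset α) (k : ℕ) :
    MvPolynomial (ℕ × ℕ) ℝ :=
  ∑ c ∈ pts S k, ∏ B ∈ c, MvPolynomial.X (cnt p B)

noncomputable def Dx : Derivation ℝ (MvPolynomial (ℕ × ℕ) ℝ) (MvPolynomial (ℕ × ℕ) ℝ) :=
  MvPolynomial.mkDerivation ℝ (fun i => MvPolynomial.X (i.1 + 1, i.2))

noncomputable def Dy : Derivation ℝ (MvPolynomial (ℕ × ℕ) ℝ) (MvPolynomial (ℕ × ℕ) ℝ) :=
  MvPolynomial.mkDerivation ℝ (fun i => if i = (0, 0) then 0 else MvPolynomial.X (i.1, i.2 + 1))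

theorem Dx_X (i : ℕ × ℕ) : Dx (MvPolynomial.X i) = MvPolynomial.X (i.1 + 1, i.2) := by
  simp [Dx, MvPolynomial.mkDerivation_X]

theorem Dy_X (i : ℕ × ℕ) : Dy (MvPolynomial.X i) =
    if i = (0, 0) then 0 else MvPolynomial.X (i.1, i.2 + 1) := by
  simp [Dy, MvPolynomial.mkDerivation_X]

theorem cnt_insert_small {α : Type*} [DecidableEq α] (p : α → Bool) (B : Finset α) (e : α)
    (he : e ∉ B) (hp : p e = true) : cnt p (insert e B) = ((cnt p B).1 + 1, (cnt p B).2) := by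
  simp [cnt, Finset.filter_insert, hp, he]

theorem cnt_insert_large {α : Type*} [DecidableEq α] (p : α → Bool) (B : Finset α) (e : α)
    (he : e ∉ B) (hp : p e = false) : cnt p (insert e B) = ((cnt p B).1, (cnt p B).2 + 1) := by
  simp [cnt, Finset.filter_insert, hp, he]

theorem cnt_add {α : Type*} (p : α → Bool) (B : Finset α) : (cnt p B).1 + (cnt p B).2 = B.card := by
  simp only [cnt]
  exact Finset.card_filter_add_card_filter_not _

theorem TX_insert_small {α : Type*} [DecidableEq α] (p : α → Bool) (S : Finset α) (e : α)
    (he : e ∉ S) (hp : p e = true) (k : ℕ) :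
    TX p (insert e S) (k+1) = MvPolynomial.X (1, 0) * TX p S k + Dx (TX p S (k+1)) := by
  unfold TX
  rw [pts_insert _ S e he k, map_sum]
  congr 1
  · congr 2
    simp [cnt, Finset.filter_singleton, hp]
  · refine Finset.sum_congr rfl fun c hc => ?_
    rw [leib_prod]
    refine Finset.sum_congr rfl fun B hB => ?_
    rw [mem_pts] at hc
    rw [cnt_insert_small p B e (fun h => he (hc.1.2.1 B hB e h)) hp, Dx_X]

theorem TX_insert_large {α : Type*} [DecidableEq α] (p : α → Bool) (S : Finset α) (e : α)
    (he : e ∉ S) (hp : p e = false) (k : ℕ) :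
    TX p (insert e S) (k+1) = MvPolynomial.X (0, 1) * TX p S k + Dy (TX p S (k+1)) := by
  unfold TX
  rw [pts_insert _ S e he k, map_sum]
  congr 1
  · congr 2
    simp [cnt, Finset.filter_singleton, hp]
  · refine Finset.sum_congr rfl fun c hc => ?_
    rw [leib_prod]
    refine Finset.sum_congr rfl fun B hB => ?_
    rw [mem_pts] at hc
    rw [cnt_insert_large p B e (fun h => he (hc.1.2.1 B hB e h)) hp, Dy_X, if_neg]
    intro h
    have h1 := cnt_add p B
    rw [h] at h1
    have := Finset.card_pos.2 (hc.1.1 B hB)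
    simp at h1
    omega

theorem TX_insert_zero {α : Type*} [DecidableEq α] (p : α → Bool) (S : Finset α) (e : α) :
    TX p (insert e S) 0 = 0 := by
  unfold TX
  refine Finset.sum_eq_zero fun c hc => ?_
  rw [mem_pts] at hc
  obtain ⟨B, hB, -⟩ := hc.1.2.2.1 e (by simp)
  have := Finset.card_eq_zero.1 hc.2
  simp [this] at hB

theorem TX_empty {α : Type*} (p : α → Bool) (k : ℕ) :
    TX p (∅ : Finset α) k = if k = 0 then 1 else 0 := by
  unfold TX
  split_ifs with h
  · subst h
    rw [Finset.sum_eq_single ∅]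
    · simp
    · intro c hc hne
      rw [mem_pts] at hc
      exact absurd (Finset.card_eq_zero.1 hc.2) hne
    · intro h
      exact absurd ((mem_pts (∅ : Finset α) 0 ∅).2 ⟨by simp [IsPt], rfl⟩) h
  · refine Finset.sum_eq_zero fun c hc => ?_
    rw [mem_pts] at hc
    obtain ⟨B, hB⟩ := Finset.card_pos.1 (by omega : 0 < c.card)
    obtain ⟨i, hi⟩ := hc.1.1 B hB
    exact absurd (hc.1.2.1 B hB i hi) (by simp)

noncomputable def Tn : ℕ → ℕ → ℕ → MvPolynomial (ℕ × ℕ) ℝ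
  | 0, 0, k => if k = 0 then 1 else 0
  | 0, _ + 1, 0 => 0
  | 0, m + 1, k + 1 => MvPolynomial.X (0, 1) * Tn 0 m k + Dy (Tn 0 m (k + 1))
  | _ + 1, _, 0 => 0
  | n + 1, m, k + 1 => MvPolynomial.X (1, 0) * Tn n m k + Dx (Tn n m (k + 1))

theorem TX_eq {α : Type*} [DecidableEq α] (p : α → Bool) (n m : ℕ) (S : Finset α) (k : ℕ)
    (h : cnt p S = (n, m)) : TX p S k = Tn n m k := by
  induction n generalizing S k with
  | zero =>
    induction m generalizing S k with
    | zero =>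
      have h1 := cnt_add p S
      rw [h] at h1
      have : S = ∅ := Finset.card_eq_zero.1 h1.symm
      subst this
      rw [TX_empty, Tn]
    | succ m ih =>
      have : 0 < (S.filter (fun i => ¬ p i = true)).card := by
        have := congrArg Prod.snd h
        simp only [cnt] at this
        omega
      obtain ⟨e, he⟩ := Finset.card_pos.1 this
      rw [Finset.mem_filter] at he
      have hp : p e = false := by simpa using he.2
      have hS := Finset.insert_erase he.1
      have hn : e ∉ S.erase e := by simp
      rw [← hS, cnt_insert_large p _ e hn hp] at h
      have h' : cnt p (S.erase e) = (0, m) := by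
        have h1 := congrArg Prod.fst h
        have h2 := congrArg Prod.snd h
        ext <;> simp at * <;> omega
      rw [← hS]
      cases k with
      | zero => rw [TX_insert_zero, Tn]
      | succ k => rw [TX_insert_large p _ e hn hp, ih _ _ h', ih _ _ h', Tn]
  | succ n ih =>
      have : 0 < (S.filter (fun i => p i = true)).card := by
        have := congrArg Prod.fst h
        simp only [cnt] at this
        omega
      obtain ⟨e, he⟩ := Finset.card_pos.1 this
      rw [Finset.mem_filter] at he
      have hp : p e = true := by simpa using he.2
      have hS := Finset.insert_erase he.1
      have hn : e ∉ S.erase e := by simp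
      rw [← hS, cnt_insert_small p _ e hn hp] at h
      have h' : cnt p (S.erase e) = (n, m) := by
        have h1 := congrArg Prod.fst h
        have h2 := congrArg Prod.snd h
        ext <;> simp at * <;> omega
      rw [← hS]
      cases k with
      | zero => rw [TX_insert_zero, Tn]
      | succ k => rw [TX_insert_small p _ e hn hp, ih _ _ h', ih _ _ h', Tn]

def stdS (n m : ℕ) : Finset (ℕ ⊕ ℕ) := (Finset.range n).disjSum (Finset.range m)

theorem cnt_stdS (n m : ℕ) : cnt Sum.isLeft (stdS n m) = (n, m) := by
  have h1 : (stdS n m).filter (fun i => Sum.isLeft i = true) = (Finset.range n).map ⟨Sum.inl, Sum.inl_injective⟩ := by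
    ext i; cases i <;> simp [stdS]
  have h2 : (stdS n m).filter (fun i => ¬ Sum.isLeft i = true) = (Finset.range m).map ⟨Sum.inr, Sum.inr_injective⟩ := by
    ext i; cases i <;> simp [stdS]
  simp only [cnt]
  rw [h1, h2]
  simp

theorem Tn_eq (n m k : ℕ) : Tn n m k = TX Sum.isLeft (stdS n m) k :=
  (TX_eq _ n m _ k (cnt_stdS n m)).symm

theorem Tn_succ_x (n m k : ℕ) :
    Tn (n + 1) m (k + 1) = MvPolynomial.X (1, 0) * Tn n m k + Dx (Tn n m (k + 1)) := by
  rw [Tn]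

theorem Tn_succ_y (n m k : ℕ) :
    Tn n (m + 1) (k + 1) = MvPolynomial.X (0, 1) * Tn n m k + Dy (Tn n m (k + 1)) := by
  have hn : (Sum.inr m : ℕ ⊕ ℕ) ∉ stdS n m := by simp [stdS]
  have h := TX_insert_large Sum.isLeft (stdS n m) (Sum.inr m) hn rfl k
  rw [TX_eq _ n (m+1) _ _ (by rw [cnt_insert_large _ _ _ hn rfl, cnt_stdS]),
    ← Tn_eq, ← Tn_eq] at h
  exact h

theorem Tn_succ_zero (n m : ℕ) : Tn (n + 1) m 0 = 0 := by rw [Tn]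

theorem D_Tn_zero (D : Derivation ℝ (MvPolynomial (ℕ × ℕ) ℝ) (MvPolynomial (ℕ × ℕ) ℝ))
    (n m : ℕ) : D (Tn n m 0) = 0 := by
  cases n <;> cases m <;> simp [Tn]

theorem pderiv_Dx (P : MvPolynomial (ℕ × ℕ) ℝ) :
    MvPolynomial.pderiv (0, 1) (Dx P) = Dx (MvPolynomial.pderiv (0, 1) P) := by
  have h : ⁅MvPolynomial.pderiv (R := ℝ) ((0, 1) : ℕ × ℕ), Dx⁆ = 0 := by
    refine MvPolynomial.derivation_ext fun i => ?_
    rw [Derivation.commutator_apply, Dx_X, MvPolynomial.pderiv_X, MvPolynomial.pderiv_X]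
    by_cases hi : i = (0, 1) <;> simp [hi]
  have := congrArg (fun D => D P) h
  simp only [Derivation.commutator_apply] at this
  exact sub_eq_zero.1 this

theorem pderiv_Dy (P : MvPolynomial (ℕ × ℕ) ℝ) :
    MvPolynomial.pderiv (0, 1) (Dy P) = Dy (MvPolynomial.pderiv (0, 1) P) := by
  have h : ⁅MvPolynomial.pderiv (R := ℝ) ((0, 1) : ℕ × ℕ), Dy⁆ = 0 := by
    refine MvPolynomial.derivation_ext fun i => ?_
    rw [Derivation.commutator_apply, Dy_X, MvPolynomial.pderiv_X]
    obtain ⟨a, b⟩ := i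
    by_cases h0 : (a, b) = (0, 0)
    · simp [h0]
    · rw [if_neg h0, MvPolynomial.pderiv_X]
      have : ¬ (a = 0 ∧ b = 0) := by simpa using h0
      by_cases hi : (a, b) = (0, 1) <;> simp [hi, this]
  have := congrArg (fun D => D P) h
  simp only [Derivation.commutator_apply] at this
  exact sub_eq_zero.1 this

theorem pderiv_Tn (n m k : ℕ) :
    MvPolynomial.pderiv (0, 1) (Tn n m (k + 1)) = (m : ℝ) • Tn n (m - 1) k := by
  induction n generalizing m k with
  | zero =>
    induction m generalizing k with
    | zero => simp [Tn]
    | succ m ih =>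
      rw [Tn_succ_y, map_add, pderiv_Dy, ih, Derivation.leibniz, MvPolynomial.pderiv_X_self,
        smul_eq_mul, smul_eq_mul, mul_one, Nat.add_sub_cancel, Derivation.map_smul]
      push_cast
      rw [add_smul, one_smul]
      cases k with
      | zero =>
        rw [D_Tn_zero, D_Tn_zero]
        cases m <;> simp [Tn]
      | succ k =>
        rw [ih]
        cases m with
        | zero => simp
        | succ m =>
          simp only [Nat.add_sub_cancel]
          rw [Tn_succ_y 0 m k, smul_add, mul_smul_comm]
          ring
  | succ n ih =>
    rw [Tn_succ_x, map_add, pderiv_Dx, ih, Derivation.leibniz,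
      MvPolynomial.pderiv_X_of_ne (by simp),
        smul_eq_mul, smul_eq_mul, mul_zero, add_zero, Derivation.map_smul]
    cases k with
    | zero => simp [D_Tn_zero, Tn]
    | succ k => rw [ih, Tn_succ_x, smul_add, mul_smul_comm]

theorem cnt_sum {α : Type*} [DecidableEq α] (p : α → Bool) (S : Finset α) (c : Finset (Finset α)) (h : IsPt c S) :
    cnt p S = (∑ B ∈ c, (cnt p B).1, ∑ B ∈ c, (cnt p B).2) := by
  obtain ⟨h1, h2, h3, h4⟩ := h
  have hS : S = c.biUnion id := by
    ext i; simp only [Finset.mem_biUnion, id]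
    exact ⟨h3 i, fun ⟨B, hB, hi⟩ => h2 B hB i hi⟩
  have hd : ∀ q : α → Bool, (S.filter (fun i => q i = true)).card = ∑ B ∈ c, (B.filter (fun i => q i = true)).card := by
    intro q
    rw [hS, Finset.filter_biUnion, Finset.card_biUnion]
    · rfl
    · intro B hB B' hB' hne
      refine Finset.disjoint_left.2 ?_
      intro i hi hi'
      exact hne (h4 B hB B' hB' i (Finset.mem_filter.1 hi).1 (Finset.mem_filter.1 hi').1)
  have h5 := hd p
  have h6 := hd (fun i => ! p i)
  simp only [cnt, h5]
  congr 1
  simpa using h6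

theorem Tn_vanish (w : ℕ × ℕ → ℝ) (hw : w (0, 1) = 0) (n m k : ℕ) (h : 2 * n + m < 2 * k) :
    MvPolynomial.eval w (Tn n m k) = 0 := by
  rw [Tn_eq, TX, map_sum]
  refine Finset.sum_eq_zero fun c hc => ?_
  rw [mem_pts] at hc
  rw [map_prod]
  by_contra hne
  rw [← ne_eq, Finset.prod_ne_zero_iff] at hne
  have hs := cnt_sum Sum.isLeft _ c hc.1
  rw [cnt_stdS] at hs
  have h1 := congrArg Prod.fst hs
  have h2 := congrArg Prod.snd hs
  simp only at h1 h2
  have : ∑ B ∈ c, 2 ≤ ∑ B ∈ c, (2 * (cnt Sum.isLeft B).1 + (cnt Sum.isLeft B).2) := by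
    refine Finset.sum_le_sum fun B hB => ?_
    have h3 := hne B hB
    rw [MvPolynomial.eval_X] at h3
    have h4 := cnt_add Sum.isLeft B
    have h5 := Finset.card_pos.2 (hc.1.1 B hB)
    by_contra hlt
    apply h3
    have : cnt Sum.isLeft B = (0, 1) := by
      ext <;> simp <;> omega
    rw [this, hw]
  rw [Finset.sum_add_distrib, ← Finset.mul_sum, ← h1, ← h2, Finset.sum_const, hc.2] at this
  simp at this
  omega

theorem Tn_hasDeriv (w : ℝ → ℕ × ℕ → ℝ) (x : ℝ)
    (D : Derivation ℝ (MvPolynomial (ℕ × ℕ) ℝ) (MvPolynomial (ℕ × ℕ) ℝ)) (n m k : ℕ)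
    (h : ∀ i : ℕ × ℕ, 1 ≤ i.1 + i.2 → i.1 + i.2 + k ≤ n + m + 1 →
      HasDerivAt (fun t => w t i) (MvPolynomial.eval (w x) (D (MvPolynomial.X i))) x) :
    HasDerivAt (fun t => MvPolynomial.eval (w t) (Tn n m k))
      (MvPolynomial.eval (w x) (D (Tn n m k))) x := by
  rw [Tn_eq, TX, map_sum, map_sum]
  simp only [map_sum]
  refine HasDerivAt.fun_sum fun c hc => ?_
  rw [mem_pts] at hc
  have hs := cnt_sum Sum.isLeft _ c hc.1
  rw [cnt_stdS] at hs
  have h1 := congrArg Prod.fst hs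
  have h2 := congrArg Prod.snd hs
  simp only at h1 h2
  have hB : ∀ B ∈ c, HasDerivAt (fun t => w t (cnt Sum.isLeft B))
      (MvPolynomial.eval (w x) (D (MvPolynomial.X (cnt Sum.isLeft B)))) x := by
    intro B hB
    have h4 := cnt_add Sum.isLeft B
    have h5 := Finset.card_pos.2 (hc.1.1 B hB)
    refine h _ (by omega) ?_
    have h6 : n + m = ∑ B ∈ c, B.card := by
      rw [h1, h2, ← Finset.sum_add_distrib]
      exact Finset.sum_congr rfl fun B _ => cnt_add _ B
    rw [← Finset.add_sum_erase _ _ hB] at h6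
    have h7 : ∑ B ∈ c.erase B, 1 ≤ ∑ B ∈ c.erase B, B.card :=
      Finset.sum_le_sum fun B' hB' => Finset.card_pos.2 (hc.1.1 B' (Finset.mem_of_mem_erase hB'))
    rw [Finset.sum_const, Finset.card_erase_of_mem hB, hc.2] at h7
    simp at h7
    omega
  clear h h1 h2 hs hc
  induction c using Finset.induction_on with
  | empty => simpa using hasDerivAt_const x (1 : ℝ)
  | insert a s ha ih =>
    have h1 := ih (fun B hB' => hB B (by simp [hB']))
    have h2 := hB a (by simp)
    simp only [Finset.prod_insert ha]
    simp only [map_mul]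
    have h3 := h2.mul h1
    simp only [MvPolynomial.eval_X]
    refine h3.congr_deriv ?_
    rw [Derivation.leibniz]
    simp only [smul_eq_mul, map_add, map_mul, MvPolynomial.eval_X]
    ring

theorem pd_y (F : ℝ → ℝ → ℝ) (a b : ℕ) (x y : ℝ) :
    pd F a (b + 1) x y = deriv (fun y' => pd F a b x y') y := by
  unfold pd
  rw [iteratedDeriv_succ]

theorem pd_x0 (F : ℝ → ℝ → ℝ) (a : ℕ) (x y : ℝ) :
    pd F (a + 1) 0 x y = deriv (fun x' => pd F a 0 x' y) x := by
  unfold pd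
  simp only [iteratedDeriv_zero]
  rw [iteratedDeriv_succ]

theorem fd_x (G : ℝ × ℝ → ℝ) (p : ℝ × ℝ) (h : DifferentiableAt ℝ G p) :
    deriv (fun x' => G (x', p.2)) p.1 = fderiv ℝ G p (1, 0) := by
  have h1 : HasDerivAt (fun x' : ℝ => (x', p.2)) ((1 : ℝ), (0 : ℝ)) p.1 :=
    (hasDerivAt_id p.1).prodMk (hasDerivAt_const p.1 p.2)
  exact (HasFDerivAt.comp_hasDerivAt (f := fun x' : ℝ => (x', p.2)) p.1 h.hasFDerivAt h1).deriv

theorem fd_y (G : ℝ × ℝ → ℝ) (p : ℝ × ℝ) (h : DifferentiableAt ℝ G p) :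
    deriv (fun y' => G (p.1, y')) p.2 = fderiv ℝ G p (0, 1) := by
  have h1 : HasDerivAt (fun y' : ℝ => (p.1, y')) ((0 : ℝ), (1 : ℝ)) p.2 :=
    (hasDerivAt_const p.2 p.1).prodMk (hasDerivAt_id p.2)
  exact (HasFDerivAt.comp_hasDerivAt (f := fun y' : ℝ => (p.1, y')) p.2 h.hasFDerivAt h1).deriv

theorem cd_apply (G : ℝ × ℝ → ℝ) (p v : ℝ × ℝ) (m : ℕ) (h : ContDiffAt ℝ (m + 1 : ℕ) G p) :
    ContDiffAt ℝ m (fun q => fderiv ℝ G q v) p :=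
  (h.fderiv_right (m := m) (by push_cast; exact le_rfl)).clm_apply contDiffAt_const

theorem pd_contDiff (F : ℝ → ℝ → ℝ) (N : ℕ) (U : Set (ℝ × ℝ)) (hU : IsOpen U)
    (hF : ∀ p ∈ U, ContDiffAt ℝ N (fun p : ℝ × ℝ => F p.1 p.2) p) (a b c : ℕ)
    (h : a + b + c = N) : ∀ p ∈ U, ContDiffAt ℝ c (fun q : ℝ × ℝ => pd F a b q.1 q.2) p := by
  induction b generalizing c with
  | zero =>
    induction a generalizing c with
    | zero =>
      intro p hp
      have := hF p hp
      simp only [zero_add] at h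
      subst h
      simpa [pd] using this
    | succ a ih =>
      intro p hp
      have h1 := ih (c + 1) (by omega)
      refine (cd_apply _ p (1, 0) c (h1 p hp)).congr_of_eventuallyEq ?_
      filter_upwards [hU.mem_nhds hp] with q hq
      rw [pd_x0, ← fd_x _ q ((h1 q hq).differentiableAt (by simp))]
  | succ b ih =>
    intro p hp
    have h1 := ih (c + 1) (by omega)
    refine (cd_apply _ p (0, 1) c (h1 p hp)).congr_of_eventuallyEq ?_
    filter_upwards [hU.mem_nhds hp] with q hq
    rw [pd_y, ← fd_y _ q ((h1 q hq).differentiableAt (by simp))]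

theorem pd_diff (F : ℝ → ℝ → ℝ) (N : ℕ) (U : Set (ℝ × ℝ)) (hU : IsOpen U)
    (hF : ∀ p ∈ U, ContDiffAt ℝ N (fun p : ℝ × ℝ => F p.1 p.2) p) (a b : ℕ)
    (h : a + b < N) (p : ℝ × ℝ) (hp : p ∈ U) :
    DifferentiableAt ℝ (fun q : ℝ × ℝ => pd F a b q.1 q.2) p :=
  (pd_contDiff F N U hU hF a b (N - (a + b)) (by omega) p hp).differentiableAt (by
    have : N - (a + b) ≠ 0 := by omega
    exact_mod_cast this)

theorem pd_fy (F : ℝ → ℝ → ℝ) (N : ℕ) (U : Set (ℝ × ℝ)) (hU : IsOpen U)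
    (hF : ∀ p ∈ U, ContDiffAt ℝ N (fun p : ℝ × ℝ => F p.1 p.2) p) (a b : ℕ)
    (h : a + b < N) (p : ℝ × ℝ) (hp : p ∈ U) :
    fderiv ℝ (fun q : ℝ × ℝ => pd F a b q.1 q.2) p (0, 1) = pd F a (b + 1) p.1 p.2 := by
  rw [pd_y, ← fd_y _ p (pd_diff F N U hU hF a b h p hp)]

theorem fderiv_symm (G : ℝ × ℝ → ℝ) (p v w : ℝ × ℝ) (h : ContDiffAt ℝ 2 G p) :
    fderiv ℝ (fun q => fderiv ℝ G q v) p w = fderiv ℝ (fun q => fderiv ℝ G q w) p v := by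
  have hs : IsSymmSndFDerivAt ℝ G p := h.isSymmSndFDerivAt (by simp)
  have hd : DifferentiableAt ℝ (fderiv ℝ G) p :=
    (h.fderiv_right (m := 1) (by norm_num)).differentiableAt (by simp)
  have key : ∀ v w, fderiv ℝ (fun q => fderiv ℝ G q v) p w = fderiv ℝ (fderiv ℝ G) p w v := by
    intro v w
    rw [fderiv_clm_apply hd (differentiableAt_const v)]
    simp
  rw [key, key]
  exact hs w v

theorem pd_fx (F : ℝ → ℝ → ℝ) (N : ℕ) (U : Set (ℝ × ℝ)) (hU : IsOpen U)
    (hF : ∀ p ∈ U, ContDiffAt ℝ N (fun p : ℝ × ℝ => F p.1 p.2) p) (a b : ℕ)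
    (h : a + b < N) (p : ℝ × ℝ) (hp : p ∈ U) :
    fderiv ℝ (fun q : ℝ × ℝ => pd F a b q.1 q.2) p (1, 0) = pd F (a + 1) b p.1 p.2 := by
  induction b generalizing p with
  | zero => rw [pd_x0, ← fd_x _ p (pd_diff F N U hU hF a 0 h p hp)]
  | succ b ih =>
    have e1 : (fun q : ℝ × ℝ => pd F a (b + 1) q.1 q.2) =ᶠ[nhds p]
        (fun q => fderiv ℝ (fun q : ℝ × ℝ => pd F a b q.1 q.2) q (0, 1)) := by
      filter_upwards [hU.mem_nhds hp] with q hq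
      rw [pd_fy F N U hU hF a b (by omega) q hq]
    have e2 : (fun q => fderiv ℝ (fun q : ℝ × ℝ => pd F a b q.1 q.2) q (1, 0)) =ᶠ[nhds p]
        (fun q : ℝ × ℝ => pd F (a + 1) b q.1 q.2) := by
      filter_upwards [hU.mem_nhds hp] with q hq
      exact ih (by omega) q hq
    have hc : ContDiffAt ℝ 2 (fun q : ℝ × ℝ => pd F a b q.1 q.2) p := by
      refine (pd_contDiff F N U hU hF a b (N - (a + b)) (by omega) p hp).of_le ?_
      have : 2 ≤ N - (a + b) := by omega
      exact_mod_cast this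
    rw [e1.fderiv_eq, fderiv_symm _ _ _ _ hc, e2.fderiv_eq,
      pd_fy F N U hU hF (a + 1) b (by omega) p hp]

theorem pd_curve (F : ℝ → ℝ → ℝ) (N : ℕ) (U : Set (ℝ × ℝ)) (hU : IsOpen U)
    (hF : ∀ p ∈ U, ContDiffAt ℝ N (fun p : ℝ × ℝ => F p.1 p.2) p) (a b : ℕ)
    (h : a + b < N) (y : ℝ → ℝ) (x : ℝ) (hp : (x, y x) ∈ U) (hy : DifferentiableAt ℝ y x) :
    HasDerivAt (fun t => pd F a b t (y t))
      (pd F (a + 1) b x (y x) + deriv y x * pd F a (b + 1) x (y x)) x := by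
  have h1 : HasDerivAt (fun t : ℝ => (t, y t)) ((1 : ℝ), deriv y x) x :=
    (hasDerivAt_id x).prodMk hy.hasDerivAt
  have h2 := HasFDerivAt.comp_hasDerivAt (f := fun t : ℝ => (t, y t)) x
    (pd_diff F N U hU hF a b h _ hp).hasFDerivAt h1
  refine h2.congr_deriv ?_
  have : ((1 : ℝ), deriv y x) = (1, 0) + deriv y x • ((0 : ℝ), (1 : ℝ)) := by
    simp
  rw [this, map_add, map_smul, pd_fx F N U hU hF a b h _ hp, pd_fy F N U hU hF a b h _ hp]
  simp

noncomputable def wv (F : ℝ → ℝ → ℝ) (x y : ℝ) : ℕ × ℕ → ℝ :=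
  fun i => if i = (0, 1) then 0 else pd F i.1 i.2 x y

open scoped Classical in
theorem coe_filter_card {N : ℕ} (B : Finset (Fin N)) (q : ℕ → Prop) [DecidablePred q] :
    (Finset.filter q (do let a ← B; pure (a : ℕ) : Finset ℕ)).card =
      (Finset.filter (fun i : Fin N => q (i : ℕ)) B).card := by
  have : (do let a ← B; pure (a : ℕ) : Finset ℕ) = B.image (fun a : Fin N => (a : ℕ)) := by
    ext i
    simp [Finset.bind_def, Finset.pure_def, eq_comm]
  rw [this, Finset.filter_image, Finset.card_image_of_injective _ Fin.val_injective]

theorem iSum_eq (F : ℝ → ℝ → ℝ) (n k : ℕ) (x y : ℝ) :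
    iSum F n ((k + 1 : ℕ) : ℤ) x y = MvPolynomial.eval (wv F x y) (Tn n k (k + 1)) := by
  classical
  unfold iSum
  rw [if_neg (by push_cast; omega)]
  have hK : ((k + 1 : ℕ) : ℤ).toNat = k + 1 := Int.toNat_natCast _
  generalize ((k + 1 : ℕ) : ℤ).toNat = K at hK
  subst hK
  have hc : cnt (fun i : Fin (n + (k + 1) - 1) => decide ((i : ℕ) < n)) Finset.univ = (n, k) := by
    have h1 : (cnt (fun i : Fin (n + (k + 1) - 1) => decide ((i : ℕ) < n)) Finset.univ).1 = n := by
      simp only [cnt, decide_eq_true_eq]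
      rw [Fin.card_filter_val_lt]
      omega
    have h2 := cnt_add (fun i : Fin (n + (k + 1) - 1) => decide ((i : ℕ) < n)) Finset.univ
    rw [Finset.card_univ, Fintype.card_fin] at h2
    ext
    · exact h1
    · simp only; omega
  rw [← TX_eq _ n k _ (k + 1) hc, TX, map_sum]
  simp only [map_prod, MvPolynomial.eval_X]
  have key : ∀ c : Finset (Finset (Fin (n + (k + 1) - 1))),
      ((∀ B ∈ c, B.Nonempty) ∧ (∀ i, ∃! B, B ∈ c ∧ i ∈ B) ∧ c.card = k + 1) ↔
      c ∈ pts Finset.univ (k + 1) := by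
    intro c
    rw [mem_pts]
    constructor
    · rintro ⟨h1, h2, h3⟩
      refine ⟨⟨h1, by simp, ?_, ?_⟩, h3⟩
      · intro i _
        obtain ⟨B, hB, -⟩ := h2 i
        exact ⟨B, hB⟩
      · intro B hB B' hB' i hi hi'
        exact (h2 i).unique ⟨hB, hi⟩ ⟨hB', hi'⟩
    · rintro ⟨⟨h1, h2, h3, h4⟩, h5⟩
      refine ⟨h1, ?_, h5⟩
      intro i
      obtain ⟨B, hB, hi⟩ := h3 i (by simp)
      exact ⟨B, ⟨hB, hi⟩, fun B' hB' => h4 _ hB'.1 _ hB i hB'.2 hi⟩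
  have hbad : ∀ B : Finset (Fin (n + (k + 1) - 1)),
      cnt (fun i : Fin (n + (k + 1) - 1) => decide ((i : ℕ) < n)) B = (0, 1) ↔
      ¬ (B.card = 1 → ∀ i ∈ B, (i : ℕ) < n) := by
    intro B
    have h2 := cnt_add (fun i : Fin (n + (k + 1) - 1) => decide ((i : ℕ) < n)) B
    constructor
    · intro h h3
      rw [h] at h2
      have h4 := h3 h2.symm
      have h5 := congrArg Prod.fst h
      simp only [cnt, decide_eq_true_eq, Finset.card_eq_zero] at h5
      obtain ⟨i, hi⟩ := Finset.card_pos.1 (by omega : 0 < B.card)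
      have : i ∈ Finset.filter (fun i : Fin (n + (k + 1) - 1) => (i : ℕ) < n) B :=
        Finset.mem_filter.2 ⟨hi, h4 i hi⟩
      rw [h5] at this
      simp at this
    · intro h
      push Not at h
      obtain ⟨h1, i, hi, hin⟩ := h
      obtain ⟨j, rfl⟩ := Finset.card_eq_one.1 h1
      rw [Finset.mem_singleton] at hi
      subst hi
      simp [cnt, Finset.filter_singleton, hin]
  have hsub : Finset.univ.filter (fun part : Finset (Finset (Fin (n + (k + 1) - 1))) =>
        (∀ B ∈ part, B.Nonempty) ∧
        (∀ i, ∃! B, B ∈ part ∧ i ∈ B) ∧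
        part.card = k + 1 ∧
        ∀ B ∈ part, B.card = 1 → ∀ i ∈ B, (i : ℕ) < n) ⊆ pts Finset.univ (k + 1) := by
    intro c hc
    rw [Finset.mem_filter] at hc
    exact (key c).1 ⟨hc.2.1, hc.2.2.1, hc.2.2.2.1⟩
  rw [← Finset.sum_subset hsub]
  · refine Finset.sum_congr rfl fun c hc => ?_
    refine Finset.prod_congr rfl fun B hB => ?_
    rw [Finset.mem_filter] at hc
    have h1 := hc.2.2.2.2 B hB
    have h2 : ¬ cnt (fun i : Fin (n + (k + 1) - 1) => decide ((i : ℕ) < n)) B = (0, 1) := by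
      rw [hbad]; exact not_not.2 h1
    rw [wv, if_neg h2]
    simp only [cnt, decide_eq_true_eq]
    congr 1
    · rw [coe_filter_card B (fun i => i < n)]
    · rw [coe_filter_card B (fun i => ¬ i < n)]
  · intro c hc hnc
    have h1 := (key c).2 hc
    have h2 : ∃ B ∈ c, ¬ (B.card = 1 → ∀ i ∈ B, (i : ℕ) < n) := by
      by_contra hcon
      apply hnc
      rw [Finset.mem_filter]
      refine ⟨by simp, h1.1, h1.2.1, h1.2.2, ?_⟩
      intro B hB
      by_contra h3
      exact hcon ⟨B, hB, h3⟩
    obtain ⟨B, hB, hb⟩ := h2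
    refine Finset.prod_eq_zero hB ?_
    rw [wv, if_pos ((hbad B).2 hb)]

theorem wv01 (F : ℝ → ℝ → ℝ) (x y : ℝ) : wv F x y (0, 1) = 0 := by simp [wv]

theorem Tn_curve (F : ℝ → ℝ → ℝ) (N : ℕ) (U : Set (ℝ × ℝ)) (hU : IsOpen U)
    (hF : ∀ p ∈ U, ContDiffAt ℝ N (fun p : ℝ × ℝ => F p.1 p.2) p)
    (y : ℝ → ℝ) (x : ℝ) (hp : (x, y x) ∈ U) (hy : DifferentiableAt ℝ y x)
    (n k : ℕ) (hn : n < N) :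
    HasDerivAt (fun t => MvPolynomial.eval (wv F t (y t)) (Tn n k (k + 1)))
      (MvPolynomial.eval (wv F x (y x)) (Tn (n + 1) k (k + 1))
        - pd F 1 0 x (y x) * MvPolynomial.eval (wv F x (y x)) (Tn n k k)
        + deriv y x * MvPolynomial.eval (wv F x (y x)) (Tn n (k + 1) (k + 1))
        - (pd F 1 1 x (y x) + deriv y x * pd F 0 2 x (y x)) *
          (k * MvPolynomial.eval (wv F x (y x)) (Tn n (k - 1) k))) x := by
  set s' := pd F 1 1 x (y x) + deriv y x * pd F 0 2 x (y x) with hs'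
  have h := Tn_hasDeriv (fun t => wv F t (y t)) x
    (Dx + (deriv y x) • Dy - s' • MvPolynomial.pderiv (0, 1)) n k (k + 1) ?_
  · refine h.congr_deriv ?_
    simp only [Derivation.sub_apply, Derivation.add_apply, Derivation.smul_apply, pderiv_Tn,
      Tn_succ_x, Tn_succ_y, map_add, map_sub, map_mul, MvPolynomial.smul_eval,
      MvPolynomial.eval_X, wv01]
    have : wv F x (y x) (1, 0) = pd F 1 0 x (y x) := by simp [wv]
    rw [this]
    ring
  · rintro ⟨a, b⟩ h1 h2
    simp only at h1 h2
    have h0 : ¬ ((a, b) : ℕ × ℕ) = (0, 0) := by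
      rw [Prod.mk.injEq]; omega
    simp only [Derivation.sub_apply, Derivation.add_apply, Derivation.smul_apply, Dx_X, Dy_X,
      if_neg h0, map_add, map_sub, MvPolynomial.smul_eval, MvPolynomial.eval_X]
    by_cases h01 : ((a, b) : ℕ × ℕ) = (0, 1)
    · rw [Prod.mk.injEq] at h01
      obtain ⟨rfl, rfl⟩ := h01
      simp only [wv01, MvPolynomial.pderiv_X_self, map_one]
      refine (hasDerivAt_const x (0 : ℝ)).congr_deriv ?_
      simp [wv, hs']
    · rw [MvPolynomial.pderiv_X_of_ne h01]
      have e1 : wv F x (y x) (a + 1, b) = pd F (a + 1) b x (y x) := by simp [wv]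
      have e2 : wv F x (y x) (a, b + 1) = pd F a (b + 1) x (y x) := by
        rw [wv, if_neg]
        rw [Prod.mk.injEq]; omega
      have e3 : (fun t => wv F t (y t) (a, b)) = fun t => pd F a b t (y t) := by
        funext t
        rw [wv, if_neg h01]
      rw [e1, e2, e3]
      refine (pd_curve F N U hU hF a b (by omega) y x hp hy).congr_deriv ?_
      simp

theorem nth_aux (F : ℝ → ℝ → ℝ) (N : ℕ) (U : Set (ℝ × ℝ)) (hU : IsOpen U)
    (hF : ∀ p ∈ U, ContDiffAt ℝ N (fun p : ℝ × ℝ => F p.1 p.2) p)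
    (y : ℝ → ℝ) (x₀ : ℝ)
    (hg : ∀ᶠ x in nhds x₀, (x, y x) ∈ U ∧ DifferentiableAt ℝ y x ∧
      pd F 0 1 x (y x) ≠ 0 ∧ deriv y x = - (pd F 0 1 x (y x))⁻¹ * pd F 1 0 x (y x))
    (K : ℕ) (hK : 2 * N < K) (j : ℕ) (hj : j + 1 ≤ N) :
    ∀ᶠ x in nhds x₀, iteratedDeriv (j + 1) y x =
      ∑ k ∈ Finset.range K, (- (pd F 0 1 x (y x))⁻¹) ^ (k + 1) *
        MvPolynomial.eval (wv F x (y x)) (Tn (j + 1) k (k + 1)) := by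
  induction j with
  | zero =>
    filter_upwards [hg] with x ⟨hxU, hyx, hs, hy'⟩
    rw [Finset.sum_eq_single_of_mem 0 (by simp; omega)]
    · rw [Tn_succ_x]
      simp [Tn, iteratedDeriv_one, hy', wv]
    · intro k _ hk
      rw [Tn_vanish _ (wv01 _ _ _) _ _ _ (by omega), mul_zero]
  | succ j ih =>
    filter_upwards [hg, (ih (by omega)).eventually_nhds] with x ⟨hxU, hyx, hs, hy'⟩ hx
    rw [iteratedDeriv_succ, Filter.EventuallyEq.deriv_eq hx]
    set r := - (pd F 0 1 x (y x))⁻¹ with hr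
    set s' := pd F 1 1 x (y x) + deriv y x * pd F 0 2 x (y x) with hs'
    have hds : HasDerivAt (fun t => pd F 0 1 t (y t)) s' x :=
      pd_curve F N U hU hF 0 1 (by omega) y x hxU hyx
    have hdr : HasDerivAt (fun t => - (pd F 0 1 t (y t))⁻¹) (r ^ 2 * s') x := by
      refine (hds.fun_inv hs).fun_neg.congr_deriv ?_
      rw [hr]; field_simp
    have hd := HasDerivAt.fun_sum (u := Finset.range K) fun k _ =>
      (hdr.fun_pow (k + 1)).fun_mul (Tn_curve F N U hU hF y x hxU hyx (j + 1) k (by omega))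
    rw [hd.deriv]
    set e := fun m k => MvPolynomial.eval (wv F x (y x)) (Tn (j + 1) m k) with he
    set u := pd F 1 0 x (y x) with hu
    have t1 := Finset.sum_range_sub (fun k => u * (r ^ (k + 1) * e k k)) K
    have t2 := Finset.sum_range_sub (fun k => s' * (k * r ^ (k + 1) * e (k - 1) k)) K
    have v1 : e K K = 0 := Tn_vanish _ (wv01 _ _ _) _ _ _ (by omega)
    have v2 : e (K - 1) K = 0 := Tn_vanish _ (wv01 _ _ _) _ _ _ (by omega)
    have v3 : e 0 0 = 0 := by simp only [he, Tn_succ_zero, map_zero]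
    simp only [v1, v2, v3, mul_zero, sub_zero, Nat.cast_zero, zero_mul] at t1 t2
    rw [← sub_eq_zero]
    refine Eq.trans ?_ ((congrArg₂ (· + ·) t1 t2).trans (add_zero 0))
    rw [← Finset.sum_sub_distrib, ← Finset.sum_add_distrib]
    refine Finset.sum_congr rfl fun k _ => ?_
    simp only [Nat.add_sub_cancel]
    rw [← hr, ← hs', hy']
    push_cast
    simp only [he]
    ring

/-- **The nth derivative of an implicit function.**
If `F` is `n`-times continuously differentiable near `(x₀, y₀)`, `y` is an
`n`-times differentiable function near `x₀` with `y x₀ = y₀`, `F (x, y x) = 0`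
near `x₀` and `F_y (x₀, y₀) ≠ 0`, then for every `n ≥ 1`,
`y⁽ⁿ⁾(x₀) = ∑_{k=1}^{2n−1} (−1)^k [F_y(x₀,y₀)]^(−k) I_{n,k}(x₀, y₀)`. -/
theorem nth_deriv_implicit (F : ℝ → ℝ → ℝ) (x₀ y₀ : ℝ) (y : ℝ → ℝ) (n : ℕ) (hn : 1 ≤ n)
    (hF : ContDiffAt ℝ n (fun p : ℝ × ℝ => F p.1 p.2) (x₀, y₀))
    (hy₀ : y x₀ = y₀)
    (hy : ∀ m < n, ∀ᶠ x in nhds x₀, DifferentiableAt ℝ (iteratedDeriv m y) x)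
    (hzero : ∀ᶠ x in nhds x₀, F x (y x) = 0)
    (hFy : pd F 0 1 x₀ y₀ ≠ 0) :
    iteratedDeriv n y x₀ =
      ∑ k ∈ Finset.Icc 1 (2 * n - 1),
        (-1 : ℝ) ^ k * (pd F 0 1 x₀ y₀) ^ (-(k : ℤ)) * iSum F n (k : ℤ) x₀ y₀ := by
  have hn0 : (n : WithTop ℕ∞) ≠ ⊤ := by simp
  obtain ⟨U, hUp, hU, hUm⟩ := eventually_nhds_iff.1 (hF.eventually (by simp))
  subst hy₀
  have hyd : ∀ᶠ x in nhds x₀, DifferentiableAt ℝ y x := by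
    simpa using hy 0 (by omega)
  have hyc : ContinuousAt y x₀ := hyd.self_of_nhds.continuousAt
  have hcc : ContinuousAt (fun t => (t, y t)) x₀ := continuousAt_id.prodMk hyc
  have hUe : ∀ᶠ x in nhds x₀, (x, y x) ∈ U := hcc.eventually_mem (hU.mem_nhds hUm)
  have hse : ∀ᶠ x in nhds x₀, pd F 0 1 x (y x) ≠ 0 := by
    have h1 := (pd_contDiff F n {p | p ∈ U} hU hUp 0 1 (n - 1) (by omega) _ hUm).continuousAt
    have h2 : ContinuousAt (fun t => pd F 0 1 t (y t)) x₀ :=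
      ContinuousAt.comp (f := fun t => (t, y t)) h1 hcc
    exact h2.eventually_ne hFy
  have hg : ∀ᶠ x in nhds x₀, (x, y x) ∈ U ∧ DifferentiableAt ℝ y x ∧
      pd F 0 1 x (y x) ≠ 0 ∧ deriv y x = - (pd F 0 1 x (y x))⁻¹ * pd F 1 0 x (y x) := by
    filter_upwards [hyd, hUe, hse, hzero.eventually_nhds] with x h1 h2 h3 h4
    refine ⟨h2, h1, h3, ?_⟩
    have h5 := pd_curve F n U hU hUp 0 0 (by omega) y x h2 h1
    have h6 : (fun t => pd F 0 0 t (y t)) =ᶠ[nhds x] fun _ => 0 := by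
      filter_upwards [h4] with t ht
      simpa [pd] using ht
    have h7 := h5.deriv
    rw [h6.deriv_eq, deriv_const] at h7
    simp only [zero_add] at h7
    field_simp
    linarith
  obtain ⟨j, rfl⟩ : ∃ j, n = j + 1 := ⟨n - 1, by omega⟩
  have hmain := (nth_aux F (j + 1) U hU hUp y x₀ hg (2 * (j + 1) + 1) (by omega) j
    le_rfl).self_of_nhds
  rw [hmain]
  have hI : Finset.Icc 1 (2 * (j + 1) - 1) = Finset.Ico 1 (2 * (j + 1)) := by
    ext i; simp only [Finset.mem_Icc, Finset.mem_Ico]; omega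
  rw [hI, Finset.sum_Ico_eq_sum_range]
  rw [← Finset.sum_subset (Finset.range_subset_range.2 (by omega : 2 * (j + 1) - 1 ≤ 2 * (j + 1) + 1))]
  · refine Finset.sum_congr rfl fun k _ => ?_
    rw [add_comm 1 k, iSum_eq, neg_pow, inv_pow, zpow_neg, zpow_natCast]
  · intro k _ hk
    rw [Finset.mem_range] at hk
    rw [Tn_vanish _ (wv01 _ _ _) _ _ _ (by omega), mul_zero]
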